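/- arXiv:1604.02631 — 3 statements merged into one kernel-verified Lean document; each statement's English description precedes it below -/
import Mathlib

section
/- In the setting of the Markovian quantization (X_t generated by a transition mapping f on [a,b]^M that is Lipschitz in its first argument with constant K_sup uniformly over the noise argument, and X_t^L its quantized version), assume additionally that f is uniformly contractive, i.e. K_sup < 1. Then sup_{t∈ℕ} esssup_{ω∈Ω} ‖X_t^L(ω) − X_t(ω)‖₁ ≤ (M(b−a)/(2L)) · (2 − K_sup)/(1 − K_sup), and hence this quantity tends to 0 as L → ∞; i.e., the convergence of the Markovian quantization is additionally uniform in t. (Second part of the paper's Lemma 4.) -/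
open Filter Topology MeasureTheory

/-- Uniform scalar midpoint quantizer on `[a,b]` with `L` levels. -/
noncomputable def scalarQuant (a b : ℝ) (L : ℕ) (x : ℝ) : ℝ :=
  a + (((min ⌊(L : ℝ) * (x - a) / (b - a)⌋ ((L : ℤ) - 1) : ℤ) : ℝ) + 1 / 2) * (b - a) / L

/-- Uniform vector quantizer on `[a,b]^M`, applied coordinatewise. -/
noncomputable def vecQuant (a b : ℝ) (L M : ℕ) (x : Fin M → ℝ) : Fin M → ℝ :=
  fun i => scalarQuant a b L (x i)

lemma exists_scalarQuant_eq {a b x : ℝ} (hab : a < b) {L : ℕ} (hL : 1 ≤ L)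
    (hx : x ∈ Set.Icc a b) :
    ∃ n : ℝ, 0 ≤ n ∧ n + 1 ≤ L ∧ a + n * ((b - a) / L) ≤ x ∧ x ≤ a + (n + 1) * ((b - a) / L) ∧
      scalarQuant a b L x = a + (n + 1 / 2) * ((b - a) / L) := by
  have hba : 0 < b - a := sub_pos.2 hab
  have hL0 : (0 : ℝ) < L := by exact_mod_cast hL
  have hd : 0 < (b - a) / L := div_pos hba hL0
  set u : ℝ := (L : ℝ) * (x - a) / (b - a) with hu
  have hxu : x = a + u * ((b - a) / L) := by
    rw [hu]; field_simp; ring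
  have hu0 : 0 ≤ u := div_nonneg (mul_nonneg hL0.le (sub_nonneg.2 hx.1)) hba.le
  have huL : u ≤ L := by
    rw [hu, div_le_iff₀ hba]
    exact mul_le_mul_of_nonneg_left (sub_le_sub_right hx.2 a) hL0.le
  have hn0 : 0 ≤ min ⌊u⌋ ((L : ℤ) - 1) := le_min (Int.floor_nonneg.2 hu0) (by omega)
  have hnL : min ⌊u⌋ ((L : ℤ) - 1) + 1 ≤ (L : ℤ) := by
    linarith [min_le_right ⌊u⌋ ((L : ℤ) - 1)]
  have hnu : ((min ⌊u⌋ ((L : ℤ) - 1) : ℤ) : ℝ) ≤ u :=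
    (Int.cast_le.2 (min_le_left _ _)).trans (Int.floor_le u)
  have hun : u ≤ ((min ⌊u⌋ ((L : ℤ) - 1) : ℤ) : ℝ) + 1 := by
    rcases min_choice ⌊u⌋ ((L : ℤ) - 1) with h | h <;> rw [h]
    · exact (Int.lt_floor_add_one u).le
    · push_cast; linarith
  refine ⟨((min ⌊u⌋ ((L : ℤ) - 1) : ℤ) : ℝ), by exact_mod_cast hn0, by exact_mod_cast hnL,
    ?_, ?_, by rw [scalarQuant, mul_div_assoc]⟩
  · rw [hxu]
    gcongr
  · nth_rewrite 1 [hxu]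
    gcongr

lemma scalarQuant_mem_Icc {a b x : ℝ} (hab : a < b) {L : ℕ} (hL : 1 ≤ L)
    (hx : x ∈ Set.Icc a b) : scalarQuant a b L x ∈ Set.Icc a b := by
  obtain ⟨n, hn0, hnL, -, -, h⟩ := exists_scalarQuant_eq hab hL hx
  have hL0 : (0 : ℝ) < L := by exact_mod_cast hL
  have hd : 0 < (b - a) / L := div_pos (sub_pos.2 hab) hL0
  have hLd : (L : ℝ) * ((b - a) / L) = b - a := mul_div_cancel₀ _ hL0.ne'
  have hle : (n + 1 / 2) * ((b - a) / L) ≤ L * ((b - a) / L) := by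
    gcongr; linarith
  have hge : 0 ≤ (n + 1 / 2) * ((b - a) / L) := by positivity
  rw [h]
  constructor <;> linarith

lemma abs_scalarQuant_sub_le {a b x : ℝ} (hab : a < b) {L : ℕ} (hL : 1 ≤ L)
    (hx : x ∈ Set.Icc a b) : |scalarQuant a b L x - x| ≤ (b - a) / (2 * L) := by
  obtain ⟨n, -, -, h₁, h₂, h⟩ := exists_scalarQuant_eq hab hL hx
  have hd : (b - a) / (2 * (L : ℝ)) = 1 / 2 * ((b - a) / L) := by ring
  rw [h, hd, abs_le]
  constructor <;> linarith

lemma sum_abs_vecQuant_sub_le {a b : ℝ} (hab : a < b) {L M : ℕ} (hL : 1 ≤ L) {x : Fin M → ℝ}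
    (hx : ∀ i, x i ∈ Set.Icc a b) :
    ∑ i, |vecQuant a b L M x i - x i| ≤ M * (b - a) / (2 * L) := by
  calc ∑ i, |vecQuant a b L M x i - x i|
      ≤ ∑ _i : Fin M, (b - a) / (2 * L) :=
        Finset.sum_le_sum fun i _ => abs_scalarQuant_sub_le hab hL (hx i)
    _ = M * (b - a) / (2 * L) := by simp [mul_div_assoc]

lemma sum_abs_sub_le_of_quantized_recursion {a b : ℝ} (hab : a < b) {L M : ℕ} (hL : 1 ≤ L)
    {g : ℕ → (Fin M → ℝ) → (Fin M → ℝ)} {K : ℝ} (hK : 0 ≤ K) (hK1 : K < 1)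
    (hrange : ∀ t x, (∀ i, x i ∈ Set.Icc a b) → ∀ i, g t x i ∈ Set.Icc a b)
    (hLip : ∀ t x x', ∑ i, |g t x i - g t x' i| ≤ K * ∑ i, |x i - x' i|)
    {x y : ℕ → Fin M → ℝ} (hx0 : ∀ i, x 0 i ∈ Set.Icc a b)
    (hx : ∀ t, x (t + 1) = g t (x t)) (hy0 : y 0 = vecQuant a b L M (x 0))
    (hy : ∀ t, y (t + 1) = vecQuant a b L M (g t (y t))) (t : ℕ) :
    ∑ i, |y t i - x t i| ≤ M * (b - a) / (2 * L) / (1 - K) := by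
  have hK' : 0 < 1 - K := sub_pos.2 hK1
  have hD : 0 ≤ (M : ℝ) * (b - a) / (2 * L) := by
    have := (sub_pos.2 hab).le
    positivity
  have hmem : ∀ t i, y t i ∈ Set.Icc a b := by
    intro t
    induction t with
    | zero => intro i; rw [hy0]; exact scalarQuant_mem_Icc hab hL (hx0 i)
    | succ t ih => intro i; rw [hy]; exact scalarQuant_mem_Icc hab hL (hrange t _ ih i)
  induction t with
  | zero =>
    rw [hy0]
    exact (sum_abs_vecQuant_sub_le hab hL hx0).trans (le_div_self hD hK' (by linarith))
  | succ t ih =>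
    rw [hy, hx]
    calc ∑ i, |vecQuant a b L M (g t (y t)) i - g t (x t) i|
        ≤ ∑ i, (|vecQuant a b L M (g t (y t)) i - g t (y t) i|
            + |g t (y t) i - g t (x t) i|) :=
          Finset.sum_le_sum fun i _ => abs_sub_le _ _ _
      _ ≤ M * (b - a) / (2 * L) + K * (M * (b - a) / (2 * L) / (1 - K)) := by
          rw [Finset.sum_add_distrib]
          exact add_le_add (sum_abs_vecQuant_sub_le hab hL (hrange t _ (hmem t)))
            ((hLip t _ _).trans (mul_le_mul_of_nonneg_left ih hK))
      _ = M * (b - a) / (2 * L) / (1 - K) := by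
          field_simp
          ring

lemma essSup_nonneg_of_nonneg {Ω : Type*} [MeasurableSpace Ω] {P : Measure Ω} [NeZero P]
    {g : Ω → ℝ} (hg : ∀ ω, 0 ≤ g ω) : 0 ≤ essSup g P := by
  rw [essSup, limsup_eq]
  refine Real.sInf_nonneg fun c hc => ?_
  obtain ⟨ω, hω⟩ := Filter.Eventually.exists (show ∀ᵐ ω ∂P, g ω ≤ c from hc)
  exact (hg ω).trans hω

lemma essSup_le_of_nonneg_of_ae_le {Ω : Type*} [MeasurableSpace Ω] {P : Measure Ω} [NeZero P]
    {g : Ω → ℝ} {C : ℝ} (hg : ∀ ω, 0 ≤ g ω) (hC : ∀ᵐ ω ∂P, g ω ≤ C) : essSup g P ≤ C := by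
  rw [essSup, limsup_eq]
  refine csInf_le ⟨0, fun c hc => ?_⟩ hC
  obtain ⟨ω, hω⟩ := Filter.Eventually.exists (show ∀ᵐ ω ∂P, g ω ≤ c from hc)
  exact (hg ω).trans hω

/-- **Lemma 4, second part (uniformly contractive case).**
If additionally the transition mapping is uniformly contractive, `K_sup < 1`, then
`sup_t esssup_ω ‖X_t^L(ω) − X_t(ω)‖₁ ≤ (M(b−a)/(2L)) (2 − K_sup)/(1 − K_sup)`;
hence this quantity tends to `0` as `L → ∞`, i.e. the convergence of the Markovian
quantization is additionally uniform in `t`. -/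
theorem uniform_convergence_of_markovian_state_quantizations_uniform
    {Ω : Type*} [MeasurableSpace Ω] (P : Measure Ω) [IsProbabilityMeasure P]
    {W : Type*} [MeasurableSpace W]
    (a b : ℝ) (hab : a < b) (M : ℕ) (hM : 1 ≤ M)
    (f : (Fin M → ℝ) → W → (Fin M → ℝ)) (Ksup : ℝ) (hKsup : 0 ≤ Ksup)
    (hcontr : Ksup < 1)
    (hrange : ∀ (x : Fin M → ℝ) (w : W), (∀ i, x i ∈ Set.Icc a b) →
      ∀ i, f x w i ∈ Set.Icc a b)
    (hLip : ∀ (x x' : Fin M → ℝ) (w : W),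
      ∑ i, |f x w i - f x' w i| ≤ Ksup * ∑ i, |x i - x' i|)
    (Wt : ℕ → Ω → W)
    (X : ℕ → Ω → (Fin M → ℝ))
    (hX0 : ∀ᵐ ω ∂P, ∀ i, X 0 ω i ∈ Set.Icc a b)
    (hX : ∀ (t : ℕ) (ω : Ω), X (t + 1) ω = f (X t ω) (Wt (t + 1) ω))
    (XL : ℕ → ℕ → Ω → (Fin M → ℝ))
    (hXL0 : ∀ (L : ℕ) (ω : Ω), XL L 0 ω = vecQuant a b L M (X 0 ω))
    (hXL : ∀ (L t : ℕ) (ω : Ω),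
      XL L (t + 1) ω = vecQuant a b L M (f (XL L t ω) (Wt (t + 1) ω))) :
    (∀ L : ℕ, 1 ≤ L →
      (⨆ t : ℕ, essSup (fun ω => ∑ i, |XL L t ω i - X t ω i|) P) ≤
        (M : ℝ) * (b - a) / (2 * L) * ((2 - Ksup) / (1 - Ksup))) ∧
    Tendsto
      (fun L : ℕ => ⨆ t : ℕ, essSup (fun ω => ∑ i, |XL L t ω i - X t ω i|) P)
      atTop (𝓝 0) := by
  have hnonneg : ∀ L t ω, 0 ≤ ∑ i, |XL L t ω i - X t ω i| := fun L t ω =>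
    Finset.sum_nonneg fun i _ => abs_nonneg _
  have hbound : ∀ L : ℕ, 1 ≤ L →
      (⨆ t : ℕ, essSup (fun ω => ∑ i, |XL L t ω i - X t ω i|) P) ≤
        (M : ℝ) * (b - a) / (2 * L) * ((2 - Ksup) / (1 - Ksup)) := by
    intro L hL
    have hba : 0 ≤ b - a := (sub_pos.2 hab).le
    have hK' : 0 < 1 - Ksup := sub_pos.2 hcontr
    have hK'' : 0 ≤ 2 - Ksup := by linarith
    refine Real.iSup_le (fun t => essSup_le_of_nonneg_of_ae_le (hnonneg L t) ?_) (by positivity)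
    filter_upwards [hX0] with ω hω
    refine (sum_abs_sub_le_of_quantized_recursion hab hL (g := fun t x => f x (Wt (t + 1) ω))
      (x := fun t => X t ω) (y := fun t => XL L t ω) hKsup hcontr (fun t x => hrange x _)
      (fun t x x' => hLip x x' _) hω (fun t => hX t ω) (hXL0 L ω) (fun t => hXL L t ω) t).trans ?_
    rw [div_eq_mul_one_div _ (1 - Ksup)]
    gcongr
    linarith
  refine ⟨hbound, ?_⟩
  have hlim : Tendsto
      (fun L : ℕ => (M : ℝ) * (b - a) / (2 * L) * ((2 - Ksup) / (1 - Ksup))) atTop (𝓝 0) := by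
    have h : Tendsto (fun L : ℕ => (2 : ℝ) * L) atTop atTop :=
      tendsto_natCast_atTop_atTop.const_mul_atTop two_pos
    simpa using (h.const_div_atTop ((M : ℝ) * (b - a))).mul_const ((2 - Ksup) / (1 - Ksup))
  refine squeeze_zero' (Eventually.of_forall fun L => ?_)
    ((eventually_ge_atTop 1).mono hbound) hlim
  exact Real.iSup_nonneg fun t => essSup_nonneg_of_nonneg (hnonneg L t)
end

section
/- For every t ∈ ℕ and every prediction horizon ρ ∈ ℕ, the unnormalized predictor satisfies E[Z_{t+ρ} Λ_t | σ(Y_0,…,Y_t)] = 𝐏^ρ E_t almost surely, where E_t = E[Z_t Λ_t | σ(Y_0,…,Y_t)]. (Prediction identity underlying the paper's Theorem 5, Grid Based Filtering/Prediction & Functionals of the State.) -/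
open MeasureTheory ProbabilityTheory

/-- The `i`-th standard basis vector of `ℝ^L`. -/
def stdBasis (L : ℕ) (i : Fin L) : Fin L → ℝ := fun j => if j = i then 1 else 0

/-- The σ-algebra generated by the random variables `Z_0, …, Z_t`. -/
def pastFilt {Ω α : Type*} [MeasurableSpace α] (Z : ℕ → Ω → α) (t : ℕ) :
    MeasurableSpace Ω :=
  ⨆ s ∈ Set.Iic t, MeasurableSpace.comap (Z s) inferInstance

namespace MeasureTheory

variable {Ω E : Type*} [NormedAddCommGroup E] [NormedSpace ℝ E] [CompleteSpace E]

/-- The σ-algebra `m₁ ⊔ m₂` is generated by the intersections of an `m₁`-measurable set with an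
`m₂`-measurable set. -/
lemma generateFrom_image2_inter_measurableSet (m₁ m₂ : MeasurableSpace Ω) :
    m₁ ⊔ m₂ = MeasurableSpace.generateFrom
      (Set.image2 (· ∩ ·) {s | MeasurableSet[m₁] s} {t | MeasurableSet[m₂] t}) := by
  apply le_antisymm
  · refine sup_le (fun s hs => ?_) (fun t ht => ?_)
    · exact MeasurableSpace.measurableSet_generateFrom
        ⟨s, hs, Set.univ, @MeasurableSet.univ _ m₂, Set.inter_univ s⟩
    · exact MeasurableSpace.measurableSet_generateFrom
        ⟨Set.univ, @MeasurableSet.univ _ m₁, t, ht, Set.univ_inter t⟩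
  · refine MeasurableSpace.generateFrom_le ?_
    rintro _ ⟨s, hs, t, ht, rfl⟩
    exact @MeasurableSet.inter _ (m₁ ⊔ m₂) _ _ (le_sup_left (b := m₂) s hs)
      (le_sup_right (a := m₁) t ht)

lemma isPiSystem_image2_inter_measurableSet (m₁ m₂ : MeasurableSpace Ω) :
    IsPiSystem (Set.image2 (· ∩ ·) {s | MeasurableSet[m₁] s} {t | MeasurableSet[m₂] t}) := by
  rintro _ ⟨s, hs, t, ht, rfl⟩ _ ⟨s', hs', t', ht', rfl⟩ -
  exact ⟨s ∩ s', @MeasurableSet.inter _ m₁ _ _ hs hs', t ∩ t',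
    @MeasurableSet.inter _ m₂ _ _ ht ht', Set.inter_inter_inter_comm s s' t t'⟩

variable {m m₁ m₂ m₀ : MeasurableSpace Ω} {μ : Measure Ω} [IsFiniteMeasure μ] {f : Ω → E}

lemma setIntegral_inter_of_indep (hm₁ : m₁ ≤ m₀) (hm₂ : m₂ ≤ m₀) (hf : StronglyMeasurable[m₁] f)
    (hfi : Integrable f μ) (hindep : Indep m₁ m₂ μ) {s t : Set Ω}
    (hs : MeasurableSet[m₁] s) (ht : MeasurableSet[m₂] t) :
    ∫ x in s ∩ t, f x ∂μ = μ.real t • ∫ x in s, f x ∂μ := by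
  have h := condExp_indep_eq hm₁ hm₂ (hf.indicator hs) hindep
  rw [Set.inter_comm, ← setIntegral_indicator (hm₁ s hs),
    ← setIntegral_condExp hm₂ (hfi.indicator (hm₁ s hs)) ht,
    setIntegral_congr_ae (hm₂ t ht) (h.mono fun x hx _ => hx), setIntegral_const,
    integral_indicator (hm₁ s hs)]

/-- Enlarging the conditioning σ-algebra `m` by a σ-algebra `m₂` independent of `m₁` does not change
the conditional expectation of an `m₁`-measurable function when `m ≤ m₁`. -/
theorem condExp_sup_of_indep (hm : m ≤ m₁) (hm₁ : m₁ ≤ m₀) (hm₂ : m₂ ≤ m₀)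
    (hf : StronglyMeasurable[m₁] f) (hindep : Indep m₁ m₂ μ) :
    μ[f | m ⊔ m₂] =ᵐ[μ] μ[f | m] := by
  by_cases hfi : Integrable f μ
  swap; · rw [condExp_of_not_integrable hfi, condExp_of_not_integrable hfi]
  have hle : m ⊔ m₂ ≤ m₀ := sup_le (hm.trans hm₁) hm₂
  have hgi : Integrable (μ[f | m]) μ := integrable_condExp
  refine (ae_eq_condExp_of_forall_setIntegral_eq hle hfi (fun _ _ _ => hgi.integrableOn)
    (fun s hs _ => ?_)
    (stronglyMeasurable_condExp.mono (le_sup_left : m ≤ m ⊔ m₂)).aestronglyMeasurable).symm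
  have htotal : ∫ x, (μ[f | m]) x ∂μ = ∫ x, f x ∂μ := integral_condExp (hm.trans hm₁)
  induction s, hs using MeasurableSpace.induction_on_inter
    (generateFrom_image2_inter_measurableSet m m₂) (isPiSystem_image2_inter_measurableSet m m₂) with
  | empty => simp
  | basic u hu =>
    obtain ⟨s, hs, t, ht, rfl⟩ := hu
    have hs' : MeasurableSet[m₁] s := hm s hs
    rw [setIntegral_inter_of_indep hm₁ hm₂ (stronglyMeasurable_condExp.mono hm) hgi hindep hs' ht,
      setIntegral_inter_of_indep hm₁ hm₂ hf hfi hindep hs' ht,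
      setIntegral_condExp (hm.trans hm₁) hfi hs]
  | compl t ht ih =>
    rw [setIntegral_compl (hle t ht) hgi, setIntegral_compl (hle t ht) hfi, htotal,
      ih (measure_lt_top μ t)]
  | iUnion u hd hu ih =>
    rw [integral_iUnion (fun i => hle _ (hu i)) hd hgi.integrableOn,
      integral_iUnion (fun i => hle _ (hu i)) hd hfi.integrableOn]
    exact tsum_congr fun i => ih i (measure_lt_top μ (u i))

end MeasureTheory

section PastFilt

variable {Ω α : Type*} [MeasurableSpace α] {Z : ℕ → Ω → α}

lemma comap_le_pastFilt {s t : ℕ} (h : s ≤ t) :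
    MeasurableSpace.comap (Z s) inferInstance ≤ pastFilt Z t :=
  le_iSup₂ (f := fun s (_ : s ∈ Set.Iic t) => MeasurableSpace.comap (Z s) inferInstance) s h

lemma pastFilt_le_iSup (t : ℕ) :
    pastFilt Z t ≤ ⨆ s : ℕ, MeasurableSpace.comap (Z s) inferInstance :=
  iSup₂_le fun s _ => le_iSup (fun s : ℕ => MeasurableSpace.comap (Z s) inferInstance) s

end PastFilt

section Filter

variable {Ω : Type*} [mΩ : MeasurableSpace Ω] {P : Measure Ω} [IsProbabilityMeasure P] {L : ℕ}
  {Z : ℕ → Ω → (Fin L → ℝ)}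

/-- Pulling a bounded factor, measurable with respect to the chain up to time `n` and an
independent σ-algebra `m`, through one transition of the chain. -/
lemma condExp_transition_mul (hmZ : ∀ t, Measurable (Z t)) {C : ℝ} (hZ : ∀ t ω j, |Z t ω j| ≤ C)
    {A : Matrix (Fin L) (Fin L) ℝ} {n : ℕ} {k : Fin L}
    (hMarkov : P[fun ω => Z (n + 1) ω k | pastFilt Z n] =ᵐ[P] fun ω => A.mulVec (Z n ω) k)
    {m : MeasurableSpace Ω} (hm : m ≤ mΩ)
    (hindep : Indep (⨆ t : ℕ, MeasurableSpace.comap (Z t) inferInstance) m P)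
    {U : Ω → ℝ} (hU : Measurable[pastFilt Z n ⊔ m] U) (hUi : Integrable U P) :
    P[fun ω => Z (n + 1) ω k * U ω | m] =ᵐ[P]
      fun ω => ∑ j, A k j * (P[fun ω' => Z n ω' j * U ω' | m]) ω := by
  have hZle : (⨆ t : ℕ, MeasurableSpace.comap (Z t) inferInstance) ≤ mΩ :=
    iSup_le fun s => (hmZ s).comap_le
  have hle : pastFilt Z n ⊔ m ≤ mΩ := sup_le ((pastFilt_le_iSup n).trans hZle) hm
  have hmZ' (t : ℕ) (j : Fin L) : Measurable[mΩ] fun ω => Z t ω j :=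
    (measurable_pi_apply j).comp (hmZ t)
  have hZi (t : ℕ) (j : Fin L) : Integrable (fun ω => Z t ω j) P :=
    .of_bound (hmZ' t j).aestronglyMeasurable C (.of_forall fun ω => hZ t ω j)
  have hZUi (t : ℕ) (j : Fin L) : Integrable (fun ω => Z t ω j * U ω) P :=
    hUi.bdd_mul (hmZ' t j).aestronglyMeasurable (.of_forall fun ω => hZ t ω j)
  have hZk : StronglyMeasurable[⨆ t : ℕ, MeasurableSpace.comap (Z t) inferInstance]
      fun ω => Z (n + 1) ω k := by
    refine Measurable.stronglyMeasurable ((measurable_pi_apply k).comp ?_)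
    exact Measurable.of_comap_le
      (le_iSup (fun t : ℕ => MeasurableSpace.comap (Z t) inferInstance) (n + 1))
  have hpull : P[fun ω => Z (n + 1) ω k * U ω | pastFilt Z n ⊔ m] =ᵐ[P]
      ∑ j, A k j • fun ω => Z n ω j * U ω := by
    filter_upwards [condExp_mul_of_stronglyMeasurable_right hU.stronglyMeasurable
        (hZUi (n + 1) k) (hZi (n + 1) k),
      condExp_sup_of_indep (pastFilt_le_iSup n) hZle hm hZk hindep, hMarkov] with ω h₁ h₂ h₃
    refine h₁.trans ?_
    simp [h₂, h₃, Matrix.mulVec, dotProduct, Finset.sum_mul, mul_assoc]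
  have hsmul : ∀ᵐ ω ∂P, ∀ j, (P[A k j • fun ω' => Z n ω' j * U ω' | m]) ω =
      A k j * (P[fun ω' => Z n ω' j * U ω' | m]) ω :=
    ae_all_iff.2 fun j => condExp_smul (A k j) (fun ω' => Z n ω' j * U ω') m
  filter_upwards [condExp_condExp_of_le (f := fun ω => Z (n + 1) ω k * U ω)
      (le_sup_right : m ≤ pastFilt Z n ⊔ m) hle, condExp_congr_ae (m := m) hpull,
    condExp_finsetSum (fun j _ => (hZUi n j).smul (A k j)) m (s := Finset.univ), hsmul]
    with ω h₁ h₂ h₃ h₄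
  rw [← h₁, h₂, h₃, Finset.sum_apply]
  exact Finset.sum_congr rfl fun j _ => h₄ j

end Filter

/-- **Prediction identity underlying Theorem 5.**
For every `t` and prediction horizon `ρ`, the unnormalized predictor satisfies
`E[Z_{t+ρ} Λ_t | σ(Y_0,…,Y_t)] = 𝐏^ρ E_t` a.s., where
`Λ_t = ∏_{s=0}^t g_s(Z_s, Y_s)` and `E_t = E[Z_t Λ_t | σ(Y_0,…,Y_t)]`. -/
theorem grid_based_prediction_identity
    {Ω : Type*} [MeasurableSpace Ω] (P : Measure Ω) [IsProbabilityMeasure P]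
    {L N : ℕ}
    (Z : ℕ → Ω → (Fin L → ℝ)) (hmZ : ∀ t, Measurable (Z t))
    (hZbasis : ∀ t ω, ∃ i : Fin L, Z t ω = stdBasis L i)
    (Pm : Matrix (Fin L) (Fin L) ℝ)
    (hPmnonneg : ∀ i j, 0 ≤ Pm i j) (hPmcol : ∀ j, ∑ i, Pm i j = 1)
    (hMarkov : ∀ t : ℕ, ∀ k : Fin L,
      (P[fun ω => Z (t + 1) ω k | pastFilt Z t]) =ᵐ[P]
        fun ω => Pm.mulVec (Z t ω) k)
    (Y : ℕ → Ω → (Fin N → ℝ)) (hmY : ∀ t, Measurable (Y t))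
    (hindep : Indep (⨆ t : ℕ, MeasurableSpace.comap (Z t) inferInstance)
                    (⨆ t : ℕ, MeasurableSpace.comap (Y t) inferInstance) P)
    (g : ℕ → (Fin L → ℝ) → (Fin N → ℝ) → ℝ) (c : ℕ → ℝ)
    (hmg : ∀ t, Measurable (Function.uncurry (g t)))
    (hg : ∀ t z y, g t z y ∈ Set.Icc (0 : ℝ) (c t)) :
    ∀ t ρ : ℕ, ∀ k : Fin L,
      (P[fun ω => Z (t + ρ) ω k * ∏ s ∈ Finset.range (t + 1), g s (Z s ω) (Y s ω)
          | pastFilt Y t]) =ᵐ[P]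
        fun ω => ∑ j,
          (Pm ^ ρ) k j *
            (P[fun ω' => Z t ω' j * ∏ s ∈ Finset.range (t + 1), g s (Z s ω') (Y s ω')
                | pastFilt Y t]) ω := by
  intro t ρ
  have hYle : pastFilt Y t ≤ ‹MeasurableSpace Ω› :=
    (pastFilt_le_iSup t).trans (iSup_le fun s => (hmY s).comap_le)
  have hZ : ∀ t ω j, |Z t ω j| ≤ 1 := fun t ω j => by
    obtain ⟨i, hi⟩ := hZbasis t ω
    rw [hi, stdBasis]
    split_ifs <;> simp
  have hΛi : Integrable (fun ω => ∏ s ∈ Finset.range (t + 1), g s (Z s ω) (Y s ω)) P := by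
    refine .of_bound (Measurable.aestronglyMeasurable ?_)
      (∏ s ∈ Finset.range (t + 1), c s) (.of_forall fun ω => ?_)
    · exact Finset.measurable_fun_prod _ fun s _ => (hmg s).comp ((hmZ s).prodMk (hmY s))
    · rw [Real.norm_of_nonneg (Finset.prod_nonneg fun s _ => (hg s _ _).1)]
      exact Finset.prod_le_prod (fun s _ => (hg s _ _).1) fun s _ => (hg s _ _).2
  induction ρ with
  | zero => intro k; simp [Matrix.one_apply]
  | succ ρ ih =>
    intro k
    have hΛ : Measurable[pastFilt Z (t + ρ) ⊔ pastFilt Y t]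
        fun ω => ∏ s ∈ Finset.range (t + 1), g s (Z s ω) (Y s ω) := by
      refine Finset.measurable_fun_prod _ fun s hs => ?_
      have hst : s ≤ t := Nat.lt_succ_iff.1 (Finset.mem_range.1 hs)
      exact (hmg s).comp (Measurable.prodMk
        (Measurable.of_comap_le ((comap_le_pastFilt (by omega)).trans le_sup_left))
        (Measurable.of_comap_le ((comap_le_pastFilt hst).trans le_sup_right)))
    filter_upwards [condExp_transition_mul hmZ hZ (hMarkov (t + ρ) k) hYle
      (indep_of_indep_of_le_right hindep (pastFilt_le_iSup t)) hΛ hΛi, ae_all_iff.2 ih]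
      with ω hstep hω
    refine hstep.trans ?_
    simp_rw [hω, pow_succ', Matrix.mul_apply, Finset.mul_sum, Finset.sum_mul, mul_assoc]
    exact Finset.sum_comm
end

section
/- Let h : ℝ → ℝ be continuous with |h(x)| ≤ B for all x, let σ > 0, α > 0, and set Z := [−(B+α), B+α]. Partition Z into L equal subintervals and for x ∈ Z let Z_L(x) be the subinterval containing x. Let μ be any probability measure on ℝ with μ(Z_L(x)) > 0. Then for every x ∈ Z and every y ∈ ℝ, | f_W(y − h(x)) − (1/μ(Z_L(x))) ∫_{Z_L(x)} f_W(y − h(θ)) μ(dθ) | ≤ δ_L(x) + f_W(α), where δ_L(x) := sup_{θ ∈ Z_L(x)} |h(x) − h(θ)| / ( σ² (2Φ(α/σ) − 1) √(2πe) ). Moreover, δ_L(x) is bounded above by 2B / ( σ² (2Φ(α/σ) − 1) √(2πe) ) uniformly in L and x, and for every fixed x ∈ Z, δ_L(x) → 0 as L → ∞. (The paper's Theorem 5: additive nonlinear autoregressions driven by truncated Gaussian noise are almost conditionally regular of type II.) -/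
open Real MeasureTheory Filter Topology

/-- The standard Gaussian density `φ(x) = (2π)^{−1/2} exp(−x²/2)`. -/
noncomputable def stdGaussian (x : ℝ) : ℝ :=
  (Real.sqrt (2 * Real.pi))⁻¹ * Real.exp (-(x ^ 2) / 2)

/-- The standard Gaussian cumulative distribution function `Φ`. -/
noncomputable def stdGaussianCDF (t : ℝ) : ℝ :=
  ∫ x in Set.Iic t, stdGaussian x

/-- The zero-location truncated Gaussian density on `[−α,α]` with scale `σ`. -/
noncomputable def truncGaussian (σ α x : ℝ) : ℝ :=
  if x ∈ Set.Icc (-α) α then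
    stdGaussian (x / σ) / (σ * (2 * stdGaussianCDF (α / σ) - 1))
  else 0

/-- The subinterval containing `x` of the uniform `L`-part partition of `[a,b]`. -/
noncomputable def subCell (a b : ℝ) (L : ℕ) (x : ℝ) : Set ℝ :=
  Set.Icc (a + ((min ⌊(L : ℝ) * (x - a) / (b - a)⌋ ((L : ℤ) - 1) : ℤ) : ℝ) * (b - a) / L)
    (a + (((min ⌊(L : ℝ) * (x - a) / (b - a)⌋ ((L : ℤ) - 1) : ℤ) : ℝ) + 1) * (b - a) / L)

/-- The local oscillation bound `δ_L(x)` of Theorem 5: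
`δ_L(x) = sup_{θ ∈ Z_L(x)} |h(x) − h(θ)| / (σ²(2Φ(α/σ) − 1)√(2πe))` on
`Z = [−(B+α), B+α]`. -/
noncomputable def deltaL (h : ℝ → ℝ) (σ α B : ℝ) (L : ℕ) (x : ℝ) : ℝ :=
  sSup ((fun θ => |h x - h θ|) '' subCell (-(B + α)) (B + α) L x) /
    (σ ^ 2 * (2 * stdGaussianCDF (α / σ) - 1) * Real.sqrt (2 * Real.pi * Real.exp 1))

theorem hasDerivAt_stdGaussian (x : ℝ) :
    HasDerivAt stdGaussian (-x * stdGaussian x) x := by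
  have h1 : HasDerivAt (fun x : ℝ => -(x ^ 2) / 2) (-x) x :=
    ((hasDerivAt_pow 2 x).neg.div_const 2).congr_deriv (by norm_num; ring)
  refine (h1.exp.const_mul (Real.sqrt (2 * Real.pi))⁻¹).congr_deriv ?_
  rw [stdGaussian]
  ring

theorem continuous_stdGaussian : Continuous stdGaussian :=
  continuous_iff_continuousAt.2 fun x => (hasDerivAt_stdGaussian x).continuousAt

theorem stdGaussian_pos (x : ℝ) : 0 < stdGaussian x := by
  unfold stdGaussian
  positivity

theorem stdGaussian_neg (x : ℝ) : stdGaussian (-x) = stdGaussian x := by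
  simp [stdGaussian]

theorem abs_mul_exp_neg_sq_div_two_le (x : ℝ) :
    |x| * Real.exp (-(x ^ 2) / 2) ≤ (Real.sqrt (Real.exp 1))⁻¹ := by
  rw [← Real.exp_half, ← Real.exp_neg]
  apply abs_le_of_sq_le_sq' _ (Real.exp_pos _).le |>.2
  rw [mul_pow, sq_abs, ← Real.exp_nat_mul, ← Real.exp_nat_mul]
  have h1 : x ^ 2 ≤ Real.exp (x ^ 2 - 1) := by
    linarith [Real.add_one_le_exp (x ^ 2 - 1)]
  calc x ^ 2 * Real.exp ((2 : ℕ) * (-(x ^ 2) / 2))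
      ≤ Real.exp (x ^ 2 - 1) * Real.exp ((2 : ℕ) * (-(x ^ 2) / 2)) := by gcongr
    _ = Real.exp ((2 : ℕ) * -(1 / 2)) := by
      rw [← Real.exp_add]
      congr 1
      push_cast
      ring

theorem abs_stdGaussian_sub_le (u v : ℝ) :
    |stdGaussian u - stdGaussian v| ≤
      (Real.sqrt (2 * Real.pi * Real.exp 1))⁻¹ * |u - v| := by
  refine Convex.norm_image_sub_le_of_norm_hasDerivWithin_le (s := Set.univ)
    (fun x _ => (hasDerivAt_stdGaussian x).hasDerivWithinAt) (fun x _ => ?_)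
    convex_univ (Set.mem_univ v) (Set.mem_univ u)
  have h1 := abs_mul_exp_neg_sq_div_two_le x
  rw [Real.norm_eq_abs, abs_mul, abs_neg, abs_of_pos (stdGaussian_pos x),
    Real.sqrt_mul (by positivity), mul_inv, stdGaussian, mul_left_comm]
  gcongr

theorem integrable_stdGaussian : Integrable stdGaussian := by
  have h := (integrable_exp_neg_mul_sq (b := 1 / 2) (by norm_num)).const_mul
    (Real.sqrt (2 * Real.pi))⁻¹
  refine h.congr (Eventually.of_forall fun x => ?_)
  simp only [stdGaussian]
  congr 2
  ring

theorem stdGaussianCDF_zero : stdGaussianCDF 0 = 1 / 2 := by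
  have h1 : ∫ x in Set.Iic (0 : ℝ), stdGaussian x = ∫ x in Set.Ioi (0 : ℝ), stdGaussian x := by
    have h := integral_comp_neg_Iic (0 : ℝ) stdGaussian
    simpa [stdGaussian_neg] using h
  have h2 : ∫ x in Set.Ioi (0 : ℝ), stdGaussian x =
      (Real.sqrt (2 * Real.pi))⁻¹ * (Real.sqrt (Real.pi / (1 / 2)) / 2) := by
    rw [← integral_gaussian_Ioi, ← integral_const_mul]
    congr 1 with x
    simp only [stdGaussian]
    congr 2
    ring
  have h3 : Real.sqrt (2 * Real.pi) ≠ 0 := by positivity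
  rw [stdGaussianCDF, h1, h2, show Real.pi / (1 / 2) = 2 * Real.pi by ring]
  field_simp

theorem half_lt_stdGaussianCDF {t : ℝ} (ht : 0 < t) : 1 / 2 < stdGaussianCDF t := by
  have h1 := intervalIntegral.integral_Iic_sub_Iic
    (integrable_stdGaussian.integrableOn (s := Set.Iic (0 : ℝ)))
    (integrable_stdGaussian.integrableOn (s := Set.Iic t))
  have h2 : 0 < ∫ x in (0 : ℝ)..t, stdGaussian x :=
    intervalIntegral.intervalIntegral_pos_of_pos
      (continuous_stdGaussian.intervalIntegrable _ _) stdGaussian_pos ht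
  have h3 : stdGaussianCDF t - stdGaussianCDF 0 = ∫ x in (0 : ℝ)..t, stdGaussian x := h1
  rw [stdGaussianCDF_zero] at h3
  linarith

theorem two_mul_stdGaussianCDF_sub_one_pos {t : ℝ} (ht : 0 < t) :
    0 < 2 * stdGaussianCDF t - 1 := by
  linarith [half_lt_stdGaussianCDF ht]

theorem truncGaussian_nonneg {σ α : ℝ} (hσ : 0 < σ) (hα : 0 < α) (x : ℝ) :
    0 ≤ truncGaussian σ α x := by
  have hc := two_mul_stdGaussianCDF_sub_one_pos (div_pos hα hσ)
  have hφ := stdGaussian_pos (x / σ)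
  unfold truncGaussian
  split_ifs
  · positivity
  · rfl

theorem measurable_truncGaussian (σ α : ℝ) : Measurable (truncGaussian σ α) := by
  refine Measurable.ite measurableSet_Icc ?_ measurable_const
  exact ((continuous_stdGaussian.comp (continuous_id.div_const σ)).div_const _).measurable

theorem truncGaussian_neg (σ α x : ℝ) : truncGaussian σ α (-x) = truncGaussian σ α x := by
  have h : -x ∈ Set.Icc (-α) α ↔ x ∈ Set.Icc (-α) α := by
    simp only [Set.mem_Icc]
    constructor <;> rintro ⟨h1, h2⟩ <;> constructor <;> linarith
  simp only [truncGaussian, h, neg_div, stdGaussian_neg]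

theorem abs_truncGaussian_sub_le_of_mem {σ α u v : ℝ} (hσ : 0 < σ) (hα : 0 < α)
    (hu : u ∈ Set.Icc (-α) α) (hv : v ∈ Set.Icc (-α) α) :
    |truncGaussian σ α u - truncGaussian σ α v| ≤
      |u - v| / (σ ^ 2 * (2 * stdGaussianCDF (α / σ) - 1) *
        Real.sqrt (2 * Real.pi * Real.exp 1)) := by
  have hc := two_mul_stdGaussianCDF_sub_one_pos (div_pos hα hσ)
  have h1 := abs_stdGaussian_sub_le (u / σ) (v / σ)
  rw [truncGaussian, truncGaussian, if_pos hu, if_pos hv, ← sub_div, abs_div,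
    abs_of_pos (mul_pos hσ hc)]
  rw [← sub_div, abs_div, abs_of_pos hσ] at h1
  refine (div_le_div_of_nonneg_right h1 (mul_pos hσ hc).le).trans_eq ?_
  have h2 : Real.sqrt (2 * Real.pi * Real.exp 1) ≠ 0 := by positivity
  field_simp

theorem truncGaussian_le_of_mem_of_notMem {σ α : ℝ} (hσ : 0 < σ) (hα : 0 < α) {u v : ℝ}
    (hu : u ∈ Set.Icc (-α) α) (hv : v ∉ Set.Icc (-α) α) :
    truncGaussian σ α u ≤
      |u - v| / (σ ^ 2 * (2 * stdGaussianCDF (α / σ) - 1) *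
        Real.sqrt (2 * Real.pi * Real.exp 1)) + truncGaussian σ α α := by
  have hc := two_mul_stdGaussianCDF_sub_one_pos (div_pos hα hσ)
  have key : ∀ w ∈ Set.Icc (-α) α, |u - w| ≤ |u - v| →
      truncGaussian σ α u ≤ |u - v| / (σ ^ 2 * (2 * stdGaussianCDF (α / σ) - 1) *
        Real.sqrt (2 * Real.pi * Real.exp 1)) + truncGaussian σ α w := by
    intro w hw h
    have h1 := (le_abs_self _).trans (abs_truncGaussian_sub_le_of_mem hσ hα hu hw)
    have h2 : |u - w| / (σ ^ 2 * (2 * stdGaussianCDF (α / σ) - 1) *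
        Real.sqrt (2 * Real.pi * Real.exp 1)) ≤
        |u - v| / (σ ^ 2 * (2 * stdGaussianCDF (α / σ) - 1) *
        Real.sqrt (2 * Real.pi * Real.exp 1)) := by gcongr
    linarith
  obtain ⟨hu1, hu2⟩ := hu
  rcases le_or_gt v α with hvα | hvα
  · have hv' : v < -α := by
      by_contra! h
      exact hv ⟨h, hvα⟩
    rw [← truncGaussian_neg σ α α]
    refine key (-α) ⟨le_rfl, by linarith⟩ ?_
    rw [abs_of_nonneg (by linarith), abs_of_nonneg (by linarith)]
    linarith
  · refine key α ⟨by linarith, le_rfl⟩ ?_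
    rw [abs_of_nonpos (by linarith), abs_of_nonpos (by linarith)]
    linarith

/-- The truncated Gaussian density is Lipschitz up to its jump at the truncation level. -/
theorem abs_truncGaussian_sub_le {σ α : ℝ} (hσ : 0 < σ) (hα : 0 < α) (u v : ℝ) :
    |truncGaussian σ α u - truncGaussian σ α v| ≤
      |u - v| / (σ ^ 2 * (2 * stdGaussianCDF (α / σ) - 1) *
        Real.sqrt (2 * Real.pi * Real.exp 1)) + truncGaussian σ α α := by
  have hc := two_mul_stdGaussianCDF_sub_one_pos (div_pos hα hσ)
  have hT := truncGaussian_nonneg hσ hα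
  by_cases hu : u ∈ Set.Icc (-α) α <;> by_cases hv : v ∈ Set.Icc (-α) α
  · linarith [abs_truncGaussian_sub_le_of_mem hσ hα hu hv, hT α]
  · have hv0 : truncGaussian σ α v = 0 := if_neg hv
    rw [hv0, sub_zero, abs_of_nonneg (hT u)]
    exact truncGaussian_le_of_mem_of_notMem hσ hα hu hv
  · have hu0 : truncGaussian σ α u = 0 := if_neg hu
    rw [hu0, zero_sub, abs_neg, abs_of_nonneg (hT v), abs_sub_comm]
    exact truncGaussian_le_of_mem_of_notMem hσ hα hv hu
  · have hu0 : truncGaussian σ α u = 0 := if_neg hu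
    have hv0 : truncGaussian σ α v = 0 := if_neg hv
    rw [hu0, hv0, sub_zero, abs_zero]
    have := hT α
    positivity

theorem abs_truncGaussian_le {σ α : ℝ} (hσ : 0 < σ) (hα : 0 < α) (x : ℝ) :
    |truncGaussian σ α x| ≤
      2 * α / (σ ^ 2 * (2 * stdGaussianCDF (α / σ) - 1) *
        Real.sqrt (2 * Real.pi * Real.exp 1)) + truncGaussian σ α α := by
  have hc := two_mul_stdGaussianCDF_sub_one_pos (div_pos hα hσ)
  have hT := truncGaussian_nonneg hσ hα α
  by_cases hx : x ∈ Set.Icc (-α) α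
  · have hαm : α ∈ Set.Icc (-α) α := ⟨by linarith, le_rfl⟩
    have h1 := (abs_truncGaussian_sub_le_of_mem hσ hα hx hαm)
    have h2 : |x - α| ≤ 2 * α := by
      rw [abs_le]
      constructor <;> linarith [hx.1, hx.2]
    have h3 : |x - α| / (σ ^ 2 * (2 * stdGaussianCDF (α / σ) - 1) *
        Real.sqrt (2 * Real.pi * Real.exp 1)) ≤
        2 * α / (σ ^ 2 * (2 * stdGaussianCDF (α / σ) - 1) *
        Real.sqrt (2 * Real.pi * Real.exp 1)) := by gcongr
    rw [abs_of_nonneg (truncGaussian_nonneg hσ hα x)]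
    linarith [le_abs_self (truncGaussian σ α x - truncGaussian σ α α)]
  · have hx0 : truncGaussian σ α x = 0 := if_neg hx
    rw [hx0, abs_zero]
    positivity

theorem abs_sub_le_of_mem_subCell {a b : ℝ} (hab : a < b) {L : ℕ} (hL : 1 ≤ L) {x θ : ℝ}
    (hx : x ∈ Set.Icc a b) (hθ : θ ∈ subCell a b L x) : |x - θ| ≤ (b - a) / L := by
  have hL' : (0 : ℝ) < L := by exact_mod_cast hL
  have hba : 0 < b - a := sub_pos.2 hab
  set k : ℤ := min ⌊(L : ℝ) * (x - a) / (b - a)⌋ ((L : ℤ) - 1) with hk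
  set t : ℝ := (L : ℝ) * (x - a) / (b - a) with ht
  have hxt : x = a + t * (b - a) / L := by
    rw [ht]
    field_simp
    ring
  have htL : t ≤ L := by
    rw [ht, div_le_iff₀ hba]
    exact mul_le_mul_of_nonneg_left (by linarith [hx.2]) hL'.le
  have hkt : (k : ℝ) ≤ t := (Int.cast_le.2 (min_le_left _ _)).trans (Int.floor_le t)
  have htk : t ≤ k + 1 := by
    rcases min_choice ⌊t⌋ ((L : ℤ) - 1) with h | h
    · rw [hk, h]
      exact (Int.lt_floor_add_one t).le
    · rw [hk, h]
      push_cast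
      linarith
  have hx1 : a + k * (b - a) / L ≤ x := by
    rw [hxt]
    gcongr
  have hx2 : x ≤ a + (k + 1) * (b - a) / L := by
    rw [hxt]
    gcongr
  have hθ1 : a + k * (b - a) / L ≤ θ := hθ.1
  have hθ2 : θ ≤ a + (k + 1) * (b - a) / L := hθ.2
  have hw : (k + 1 : ℝ) * (b - a) / L = k * (b - a) / L + (b - a) / L := by ring
  rw [abs_le]
  constructor <;> linarith

theorem deltaL_le_div {h : ℝ → ℝ} {σ α B : ℝ} (hσ : 0 < σ) (hα : 0 < α) {L : ℕ} {x C : ℝ}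
    (hC : 0 ≤ C) (hosc : ∀ θ ∈ subCell (-(B + α)) (B + α) L x, |h x - h θ| ≤ C) :
    deltaL h σ α B L x ≤ C / (σ ^ 2 * (2 * stdGaussianCDF (α / σ) - 1) *
      Real.sqrt (2 * Real.pi * Real.exp 1)) := by
  have hc := two_mul_stdGaussianCDF_sub_one_pos (div_pos hα hσ)
  refine div_le_div_of_nonneg_right (Real.sSup_le ?_ hC) (by positivity)
  rintro _ ⟨θ, hθ, rfl⟩
  exact hosc θ hθ

theorem deltaL_nonneg (h : ℝ → ℝ) {σ α : ℝ} (B : ℝ) (hσ : 0 < σ) (hα : 0 < α) (L : ℕ) (x : ℝ) :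
    0 ≤ deltaL h σ α B L x := by
  have hc := two_mul_stdGaussianCDF_sub_one_pos (div_pos hα hσ)
  refine div_nonneg (Real.sSup_nonneg ?_) (by positivity)
  rintro _ ⟨θ, -, rfl⟩
  exact abs_nonneg _

theorem abs_sub_setIntegral_div_le {Ω : Type*} [MeasurableSpace Ω] {μ : Measure Ω}
    [IsFiniteMeasure μ] {s : Set Ω} (hμs : 0 < μ s) {g : Ω → ℝ}
    (hg : IntegrableOn g s μ) {c C : ℝ} (hC : ∀ ω ∈ s, |c - g ω| ≤ C) :
    |c - (∫ ω in s, g ω ∂μ) / (μ s).toReal| ≤ C := by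
  have hm : 0 < (μ s).toReal := ENNReal.toReal_pos hμs.ne' (measure_ne_top μ s)
  have h1 : ∫ ω in s, (c - g ω) ∂μ = c * (μ s).toReal - ∫ ω in s, g ω ∂μ := by
    rw [integral_sub (integrable_const c) hg, setIntegral_const, smul_eq_mul, mul_comm]
    rfl
  have h2 : ‖∫ ω in s, (c - g ω) ∂μ‖ ≤ C * (μ s).toReal :=
    norm_setIntegral_le_of_norm_le_const (measure_lt_top μ s) hC
  rw [h1, Real.norm_eq_abs] at h2
  have h3 : c - (∫ ω in s, g ω ∂μ) / (μ s).toReal =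
      (c * (μ s).toReal - ∫ ω in s, g ω ∂μ) / (μ s).toReal := by
    field_simp
  rwa [h3, abs_div, abs_of_pos hm, div_le_iff₀ hm]

/-- **Theorem 5 (Additive NARs are almost CRT II).**
For the additive nonlinear autoregression with kernel density
`κ(y|x) = f_W(y − h(x))`, the deviation of `κ(y|x)` from the cumulative kernel
density over the cell `Z_L(x)` is at most `δ_L(x) + f_W(α)`; moreover `δ_L(x)` is
bounded by `2B/(σ²(2Φ(α/σ)−1)√(2πe))` uniformly in `L` and `x`, and
`δ_L(x) → 0` as `L → ∞` for every fixed `x`. -/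
theorem additive_NAR_almost_CRT_II
    (h : ℝ → ℝ) (hcont : Continuous h) (B : ℝ) (hB : 0 < B)
    (hhB : ∀ x, |h x| ≤ B)
    (σ α : ℝ) (hσ : 0 < σ) (hα : 0 < α)
    (μ : Measure ℝ) [IsProbabilityMeasure μ]
    (hμ : ∀ L : ℕ, 1 ≤ L → ∀ x ∈ Set.Icc (-(B + α)) (B + α),
      0 < μ (subCell (-(B + α)) (B + α) L x)) :
    (∀ L : ℕ, 1 ≤ L → ∀ x ∈ Set.Icc (-(B + α)) (B + α), ∀ y : ℝ,
      |truncGaussian σ α (y - h x) -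
        (∫ θ in subCell (-(B + α)) (B + α) L x, truncGaussian σ α (y - h θ) ∂μ) /
          (μ (subCell (-(B + α)) (B + α) L x)).toReal| ≤
        deltaL h σ α B L x + truncGaussian σ α α) ∧
    (∀ L : ℕ, 1 ≤ L → ∀ x ∈ Set.Icc (-(B + α)) (B + α),
      deltaL h σ α B L x ≤
        2 * B / (σ ^ 2 * (2 * stdGaussianCDF (α / σ) - 1) *
          Real.sqrt (2 * Real.pi * Real.exp 1))) ∧
    (∀ x ∈ Set.Icc (-(B + α)) (B + α),
      Tendsto (fun L : ℕ => deltaL h σ α B L x) atTop (𝓝 0)) := by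
  have hc := two_mul_stdGaussianCDF_sub_one_pos (div_pos hα hσ)
  have hosc : ∀ x θ, |h x - h θ| ≤ 2 * B := fun x θ => by
    linarith [abs_sub (h x) (h θ), hhB x, hhB θ]
  refine ⟨fun L hL x hx y => ?_, fun L hL x hx => ?_, fun x hx => ?_⟩
  · refine abs_sub_setIntegral_div_le (hμ L hL x hx) ?_ fun θ hθ => ?_
    · refine Integrable.of_bound (C := 2 * α / (σ ^ 2 * (2 * stdGaussianCDF (α / σ) - 1) *
        Real.sqrt (2 * Real.pi * Real.exp 1)) + truncGaussian σ α α) ?_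
        (Eventually.of_forall fun θ => abs_truncGaussian_le hσ hα _)
      exact ((measurable_truncGaussian σ α).comp
        (hcont.measurable.const_sub y)).aestronglyMeasurable
    · refine (abs_truncGaussian_sub_le hσ hα _ _).trans ?_
      rw [sub_sub_sub_cancel_left, abs_sub_comm]
      refine add_le_add_left (div_le_div_of_nonneg_right ?_ (by positivity)) _
      refine le_csSup ⟨2 * B, ?_⟩ ⟨θ, hθ, rfl⟩
      rintro _ ⟨θ', -, rfl⟩
      exact hosc x θ'
  · exact deltaL_le_div hσ hα (by positivity) fun θ _ => hosc x θ
  · set D := σ ^ 2 * (2 * stdGaussianCDF (α / σ) - 1) *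
      Real.sqrt (2 * Real.pi * Real.exp 1) with hD
    have hDpos : 0 < D := by positivity
    rw [Metric.tendsto_atTop']
    intro ε hε
    obtain ⟨r, hr, hr'⟩ := Metric.continuous_iff.1 hcont x (ε * D / 2) (by positivity)
    obtain ⟨N, hN⟩ := exists_nat_gt ((B + α - -(B + α)) / r)
    refine ⟨N, fun L hL => ?_⟩
    have hL1 : 1 ≤ L := by omega
    have hLpos : (0 : ℝ) < L := by exact_mod_cast hL1
    have hLr : (B + α - -(B + α)) / L < r := by
      rw [div_lt_iff₀ hr] at hN
      rw [div_lt_iff₀ hLpos, mul_comm]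
      refine hN.trans ?_
      gcongr
    have hδ : deltaL h σ α B L x ≤ ε * D / 2 / D := by
      refine deltaL_le_div hσ hα (by positivity) fun θ hθ => ?_
      have h1 := abs_sub_le_of_mem_subCell (by linarith) hL1 hx hθ
      have h2 := hr' θ (by rw [dist_comm, Real.dist_eq]; linarith)
      rw [dist_comm, Real.dist_eq] at h2
      exact h2.le
    rw [Real.dist_eq, sub_zero, abs_of_nonneg (deltaL_nonneg h B hσ hα L x)]
    have h3 : ε * D / 2 / D = ε / 2 := by
      field_simp
    linarith
end
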